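/- arXiv:0910.3817 — 2 statements merged into one kernel-verified Lean document; each statement's English description precedes it below -/
import Mathlib

section
/- Let K be a unital commutative ring and q ∈ K with [N]_q = 0 and [n]_q invertible in K for all 1 ≤ n ≤ N−1 (N ≥ 2). Let R be an associative unital K-algebra and a, b ∈ R with b·a = q·(a·b). Then (a + b)^N = a^N + b^N. -/
/-- The `q`-integer `[n]_q = 1 + q + … + q^{n-1}`, with `[0]_q = 0`. -/
def qInt {K : Type*} [CommRing K] (q : K) (n : ℕ) : K :=
  ∑ k ∈ Finset.range n, q ^ k

/-- The Gaussian binomial coefficients, defined by the `q`-Pascal recursion. -/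
def gaussBinom {K : Type*} [CommRing K] (q : K) : ℕ → ℕ → K
  | _, 0 => 1
  | 0, _ + 1 => 0
  | n + 1, k + 1 => gaussBinom q n k + q ^ (k + 1) * gaussBinom q n (k + 1)

section

variable {K : Type*} [CommRing K] (q : K)

theorem qInt_zero : qInt q 0 = 0 := by simp [qInt]

theorem qInt_succ (n : ℕ) : qInt q (n + 1) = 1 + q * qInt q n := by
  simp only [qInt, Finset.sum_range_succ', Finset.mul_sum, pow_succ', pow_zero]
  ring

theorem gaussBinom_zero_right (n : ℕ) : gaussBinom q n 0 = 1 := by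
  cases n <;> rfl

theorem gaussBinom_succ_succ (n k : ℕ) :
    gaussBinom q (n + 1) (k + 1) =
      gaussBinom q n k + q ^ (k + 1) * gaussBinom q n (k + 1) := rfl

theorem gaussBinom_eq_zero_of_lt {n k : ℕ} (hnk : n < k) : gaussBinom q n k = 0 := by
  induction n generalizing k with
  | zero => cases k with
    | zero => omega
    | succ k => rfl
  | succ n ih => cases k with
    | zero => omega
    | succ k =>
      rw [gaussBinom_succ_succ, ih (by omega), ih (by omega)]
      ring

theorem gaussBinom_self (n : ℕ) : gaussBinom q n n = 1 := by
  induction n with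
  | zero => rfl
  | succ n ih =>
    rw [gaussBinom_succ_succ, ih, gaussBinom_eq_zero_of_lt q n.lt_succ_self]
    ring

theorem qInt_mul_gaussBinom_succ_succ (n k : ℕ) :
    qInt q (k + 1) * gaussBinom q (n + 1) (k + 1) = qInt q (n + 1) * gaussBinom q n k := by
  induction n generalizing k with
  | zero => cases k with
    | zero => rw [gaussBinom_self, gaussBinom_self]
    | succ k =>
      rw [gaussBinom_eq_zero_of_lt q (by omega), gaussBinom_eq_zero_of_lt q (by omega)]
      ring
  | succ n ih =>
    rw [gaussBinom_succ_succ, mul_add, mul_left_comm, ih k]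
    cases k with
    | zero =>
      simp only [gaussBinom_zero_right, qInt_succ, qInt_zero]
      ring
    | succ j =>
      have hj := ih j
      have hp := gaussBinom_succ_succ q n j
      rw [qInt_succ q (j + 1), qInt_succ q (n + 1)]
      linear_combination q * hj - q * qInt q (n + 1) * hp

variable {q} {R : Type*} [Ring R] [Algebra K R] {a b : R}

theorem mul_pow_of_mul_eq_smul (h : b * a = q • (a * b)) (n : ℕ) :
    b * a ^ n = q ^ n • (a ^ n * b) := by
  induction n with
  | zero => simp
  | succ n ih =>
    rw [pow_succ, ← mul_assoc, ih, smul_mul_assoc, mul_assoc, h, mul_smul_comm, smul_smul,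
      ← pow_succ, mul_assoc]

/-- The `q`-binomial theorem. -/
theorem add_pow_eq_sum_gaussBinom (h : b * a = q • (a * b)) (n : ℕ) :
    (a + b) ^ n =
      ∑ p ∈ Finset.HasAntidiagonal.antidiagonal n, gaussBinom q n p.1 • (a ^ p.1 * b ^ p.2) := by
  induction n with
  | zero => simp [gaussBinom_zero_right]
  | succ n ih =>
    have hb : b * (a + b) ^ n = ∑ p ∈ Finset.HasAntidiagonal.antidiagonal (n + 1),
        (q ^ p.1 * gaussBinom q n p.1) • (a ^ p.1 * b ^ p.2) := by
      rw [Finset.Nat.sum_antidiagonal_succ', gaussBinom_eq_zero_of_lt q n.lt_succ_self, ih,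
        Finset.mul_sum, mul_zero, zero_smul, zero_add]
      refine Finset.sum_congr rfl fun p _ => ?_
      rw [mul_smul_comm, ← mul_assoc, mul_pow_of_mul_eq_smul h, smul_mul_assoc, smul_smul,
        mul_assoc, ← pow_succ', mul_comm]
    rw [pow_succ', add_mul, hb, ih, Finset.mul_sum, Finset.Nat.sum_antidiagonal_succ,
      Finset.Nat.sum_antidiagonal_succ, add_left_comm, ← Finset.sum_add_distrib]
    congr 1
    · simp [gaussBinom_zero_right]
    · refine Finset.sum_congr rfl fun p _ => ?_
      rw [gaussBinom_succ_succ, add_smul, mul_smul_comm, ← mul_assoc, ← pow_succ']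

end

/-- Under assumption (A) (`[N]_q = 0` and `[n]_q` invertible for
`1 ≤ n ≤ N-1`), if `b * a = q • (a * b)` in an associative unital
`K`-algebra `R`, then `(a + b)^N = a^N + b^N`. -/
theorem add_pow_N {K : Type*} [CommRing K] (q : K) (N : ℕ) (hN : 2 ≤ N)
    (hNq : qInt q N = 0)
    (hinv : ∀ n : ℕ, 1 ≤ n → n ≤ N - 1 → IsUnit (qInt q n))
    {R : Type*} [Ring R] [Algebra K R] (a b : R)
    (h : b * a = q • (a * b)) :
    (a + b) ^ N = a ^ N + b ^ N := by
  obtain ⟨m, rfl⟩ : ∃ m, N = m + 2 := ⟨N - 2, by omega⟩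
  rw [add_pow_eq_sum_gaussBinom h, Finset.Nat.sum_antidiagonal_succ,
    Finset.Nat.sum_antidiagonal_succ', Finset.sum_eq_zero]
  · simp [gaussBinom_zero_right, gaussBinom_self, add_comm (b ^ _)]
  · intro p hp
    rw [Finset.HasAntidiagonal.mem_antidiagonal] at hp
    have hmul := qInt_mul_gaussBinom_succ_succ q (m + 1) p.1
    rw [hNq, zero_mul] at hmul
    rw [(hinv (p.1 + 1) (by omega) (by omega)).mul_right_eq_zero.mp hmul, zero_smul]
end

section
/- Let K be a unital commutative ring and q ∈ K with [N]_q = 0 and [n]_q invertible in K for all 1 ≤ n ≤ N−1 (N ≥ 2). Let A = ⊕_{n∈ℤ} Aⁿ be an associative ℤ-graded K-algebra with a K-linear map d homogeneous of degree 1 satisfying d(xy) = d(x)·y + qⁿ·x·d(y) for x ∈ Aⁿ, y ∈ A. If x ∈ Aⁿ and y ∈ A satisfy d^N(x) = 0 and d^N(y) = 0, then d^N(xy) = d^N(x)·y + x·d^N(y) = 0. -/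
theorem qInt_add {K : Type*} [CommRing K] (q : K) (m n : ℕ) :
    qInt q (m + n) = qInt q m + q ^ m * qInt q n := by
  simp only [qInt, Finset.sum_range_add, Finset.mul_sum, pow_add]

/-- The `q`-factorial `[n]_q! = [1]_q [2]_q ⋯ [n]_q`. -/
def qFactorial {K : Type*} [CommRing K] (q : K) (n : ℕ) : K :=
  ∏ k ∈ Finset.range n, qInt q (k + 1)

theorem qFactorial_succ {K : Type*} [CommRing K] (q : K) (n : ℕ) :
    qFactorial q (n + 1) = qFactorial q n * qInt q (n + 1) :=
  Finset.prod_range_succ _ _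

/-- The Gaussian binomial coefficient of `i + j` over `i`, defined by the `q`-Pascal rule. -/
def qBinom {K : Type*} [CommRing K] (q : K) : ℕ → ℕ → K
  | 0, _ => 1
  | _ + 1, 0 => 1
  | i + 1, j + 1 => qBinom q i (j + 1) + q ^ (i + 1) * qBinom q (i + 1) j

theorem qBinom_zero_left {K : Type*} [CommRing K] (q : K) (j : ℕ) : qBinom q 0 j = 1 := by
  simp [qBinom]

theorem qBinom_zero_right {K : Type*} [CommRing K] (q : K) (i : ℕ) : qBinom q i 0 = 1 := by
  cases i <;> simp [qBinom]

theorem qBinom_succ_succ {K : Type*} [CommRing K] (q : K) (i j : ℕ) :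
    qBinom q (i + 1) (j + 1) = qBinom q i (j + 1) + q ^ (i + 1) * qBinom q (i + 1) j := by
  simp [qBinom]

theorem qBinom_mul_qFactorial_mul_qFactorial {K : Type*} [CommRing K] (q : K) (i j : ℕ) :
    qBinom q i j * (qFactorial q i * qFactorial q j) = qFactorial q (i + j) := by
  induction i generalizing j with
  | zero => simp [qBinom_zero_left, qFactorial]
  | succ i ihi =>
    induction j with
    | zero => simp [qBinom_zero_right, qFactorial]
    | succ j ihj =>
      have hi := ihi (j + 1)
      rw [show i + (j + 1) = i + 1 + j by ring] at hi
      rw [← add_assoc, qFactorial_succ q (i + 1 + j), add_assoc (i + 1) j 1,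
        qInt_add q (i + 1) (j + 1), qBinom_succ_succ]
      rw [qFactorial_succ q j] at hi ⊢
      rw [qFactorial_succ q i] at ihj ⊢
      linear_combination qInt q (i + 1) * hi + q ^ (i + 1) * qInt q (j + 1) * ihj

theorem isUnit_qFactorial {K : Type*} [CommRing K] {q : K} {m : ℕ}
    (h : ∀ n, 1 ≤ n → n ≤ m → IsUnit (qInt q n)) : IsUnit (qFactorial q m) := by
  induction m with
  | zero => simp [qFactorial]
  | succ m ih =>
    rw [qFactorial_succ]
    exact (ih fun n h1 h2 => h n h1 (by lia)).mul (h _ (by lia) le_rfl)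

theorem qBinom_eq_zero {K : Type*} [CommRing K] {q : K} {i j : ℕ} (hi : i ≠ 0) (hj : j ≠ 0)
    (h0 : qInt q (i + j) = 0) (h : ∀ n, 1 ≤ n → n ≤ i + j - 1 → IsUnit (qInt q n)) :
    qBinom q i j = 0 := by
  have hu : IsUnit (qFactorial q i * qFactorial q j) :=
    (isUnit_qFactorial fun n h1 h2 => h n h1 (by lia)).mul
      (isUnit_qFactorial fun n h1 h2 => h n h1 (by lia))
  have hf : qFactorial q (i + j) = 0 := by
    obtain ⟨m, hm⟩ := Nat.exists_eq_succ_of_ne_zero (show i + j ≠ 0 by lia)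
    rw [hm] at h0 ⊢
    rw [Nat.succ_eq_add_one, qFactorial_succ, ← Nat.succ_eq_add_one, h0, mul_zero]
  rw [← hu.mul_left_eq_zero, qBinom_mul_qFactorial_mul_qFactorial, hf]

/-- The `q`-Pascal rule summed against a doubly indexed family. -/
theorem sum_antidiagonal_qBinom_succ {K M : Type*} [CommRing K] [AddCommGroup M] [Module K M]
    (q t : K) (P : ℕ → ℕ → M) (m : ℕ) :
    ∑ p ∈ Finset.HasAntidiagonal.antidiagonal (m + 1), (qBinom q p.1 p.2 * t ^ p.2) • P p.1 p.2 =
      ∑ p ∈ Finset.HasAntidiagonal.antidiagonal m, (qBinom q p.1 p.2 * t ^ p.2) •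
        (P (p.1 + 1) p.2 + (t * q ^ p.1) • P p.1 (p.2 + 1)) := by
  let L : ℕ × ℕ → K := fun p => if p.1 = 0 then 0 else qBinom q (p.1 - 1) p.2 * t ^ p.2
  let R : ℕ × ℕ → K := fun p =>
    if p.2 = 0 then 0 else qBinom q p.1 (p.2 - 1) * t ^ (p.2 - 1) * (t * q ^ p.1)
  have hsplit : ∀ p ∈ Finset.HasAntidiagonal.antidiagonal (m + 1),
      (qBinom q p.1 p.2 * t ^ p.2) • P p.1 p.2 = L p • P p.1 p.2 + R p • P p.1 p.2 := by
    rintro ⟨i, j⟩ hp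
    rw [← add_smul]
    congr 1
    rcases i with _ | i <;> rcases j with _ | j
    · simp at hp
    · simp [L, R, qBinom_zero_left, pow_succ]
    · simp [L, R, qBinom_zero_right]
    · simp only [L, R, qBinom_succ_succ, Nat.add_eq_zero_iff, one_ne_zero, and_false, if_false,
        Nat.add_sub_cancel]
      ring
  rw [Finset.sum_congr rfl hsplit, Finset.sum_add_distrib, Finset.Nat.sum_antidiagonal_succ,
    Finset.Nat.sum_antidiagonal_succ' (n := m)]
  simp [L, R, smul_add, Finset.sum_add_distrib, mul_smul]

/-- The `q`-binomial expansion of an iterated twisted derivation on a product. -/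
theorem pow_twisted_leibniz {K : Type*} [CommRing K] (q : Kˣ) {A : Type*} [Ring A] [Algebra K A]
    (𝒜 : ℤ → Submodule K A) (d : Module.End K A)
    (hd : ∀ (n : ℤ), ∀ x ∈ 𝒜 n, d x ∈ 𝒜 (n + 1))
    (hLeib : ∀ (n : ℤ), ∀ x ∈ 𝒜 n, ∀ y : A,
      d (x * y) = d x * y + ((q ^ n : Kˣ) : K) • (x * d y))
    {n : ℤ} {x : A} (hx : x ∈ 𝒜 n) (y : A) (m : ℕ) :
    (d ^ m) (x * y) = ∑ p ∈ Finset.HasAntidiagonal.antidiagonal m,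
      (qBinom (q : K) p.1 p.2 * ((q ^ n : Kˣ) : K) ^ p.2) • ((d ^ p.1) x * (d ^ p.2) y) := by
  have hmem (i : ℕ) : (d ^ i) x ∈ 𝒜 (n + i) := by
    induction i with
    | zero => simpa using hx
    | succ i ih =>
      rw [pow_succ', Module.End.mul_apply, Nat.cast_succ, ← add_assoc]
      exact hd _ _ ih
  induction m with
  | zero => simp [qBinom_zero_left]
  | succ m ih =>
    rw [sum_antidiagonal_qBinom_succ (q : K) _ (fun i j => (d ^ i) x * (d ^ j) y), pow_succ',
      Module.End.mul_apply, ih, map_sum]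
    refine Finset.sum_congr rfl fun p _ => ?_
    rw [map_smul, hLeib _ _ (hmem p.1), pow_succ' d, pow_succ' d, Module.End.mul_apply,
      Module.End.mul_apply, zpow_add, zpow_natCast, Units.val_mul, Units.val_pow_eq_pow_val]

/-- Under assumption (A) (`[N]_q = 0` and `[n]_q` invertible for `1 ≤ n ≤ N-1`),
let `A` be an associative `ℤ`-graded `K`-algebra with a degree-1 `K`-linear map
`d` satisfying the twisted Leibniz rule.  If `x` is homogeneous of degree `n`
with `d^N x = 0` and `d^N y = 0`, then
`d^N (x * y) = d^N x * y + x * d^N y = 0`. -/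
theorem pow_N_twisted_leibniz {K : Type*} [CommRing K] (q : Kˣ)
    (N : ℕ) (hN : 2 ≤ N) (hNq : qInt (q : K) N = 0)
    (hinv : ∀ n : ℕ, 1 ≤ n → n ≤ N - 1 → IsUnit (qInt (q : K) n))
    {A : Type*} [Ring A] [Algebra K A]
    (𝒜 : ℤ → Submodule K A) (hA : DirectSum.IsInternal 𝒜)
    (hone : (1 : A) ∈ 𝒜 0)
    (hmul : ∀ (m n : ℤ), ∀ x ∈ 𝒜 m, ∀ y ∈ 𝒜 n, x * y ∈ 𝒜 (m + n))
    (d : Module.End K A)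
    (hd : ∀ (n : ℤ), ∀ x ∈ 𝒜 n, d x ∈ 𝒜 (n + 1))
    (hLeib : ∀ (n : ℤ), ∀ x ∈ 𝒜 n, ∀ y : A,
      d (x * y) = d x * y + ((q ^ n : Kˣ) : K) • (x * d y))
    (n : ℤ) (x : A) (hx : x ∈ 𝒜 n) (y : A)
    (hdx : (d ^ N) x = 0) (hdy : (d ^ N) y = 0) :
    (d ^ N) (x * y) = (d ^ N) x * y + x * (d ^ N) y ∧
      (d ^ N) (x * y) = 0 := by
  have hzero : (d ^ N) (x * y) = 0 := by
    rw [pow_twisted_leibniz q 𝒜 d hd hLeib hx y N]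
    refine Finset.sum_eq_zero fun p hp => ?_
    obtain ⟨i, j⟩ := p
    obtain rfl : i + j = N := Finset.HasAntidiagonal.mem_antidiagonal.mp hp
    rcases eq_or_ne i 0 with rfl | hi
    · rw [zero_add] at hdy
      simp [hdy]
    rcases eq_or_ne j 0 with rfl | hj
    · rw [add_zero] at hdx
      simp [hdx]
    simp [qBinom_eq_zero hi hj hNq hinv]
  exact ⟨by rw [hzero, hdx, hdy, zero_mul, mul_zero, add_zero], hzero⟩
end
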